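/- Suppose there is an arc (i, m) from follower i ∈ 𝒱_F into follower m ∈ 𝒱_F present in G_{σ(t)} for t ∈ [t₀, t₀ + τ_D), and that dist(x_i(t), ℒ(y(t))) ≤ δ₀ |x(t₀)|_{ℒ(y(t₀))} + c̃₀ for all t ∈ [t₀, t₀ + τ_D), for constants δ₀ ∈ (0,1) and c̃₀ > 0. Then there exists a strictly decreasing function φ_{δ₀} : [0, τ_D] → (0, 1] with φ_{δ₀}(0) = 1 (depending only on n, a_*, a^*, τ_D, δ₀) such that dist(x_m(t), ℒ(y(t))) ≤ φ_{δ₀}(t − t₀) · |x(t₀)|_{ℒ(y(t₀))} + c̃₀ + 2√2 ∫_{t₀}^{t₀+τ_D} |z(s)| ds for all t ∈ [t₀, t₀ + τ_D]. -/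

import Mathlib

open Metric Set Filter MeasureTheory

noncomputable section

/-- Data of the multi-agent system (5): the switching communication topology
(neighbor sets `Nb`, leader sets `Ld`), the weight functions `A` (= `a_{ij}`),
`B` (= `b_{ij}`), the dwell time `τD` and the weight bounds `aLo = a_*`,
`aHi = a^*`, `bLo = b_*`, together with Assumptions 1 and 2. -/
structure MASData (d n k : ℕ) where
  hn : 2 ≤ n
  hk : 1 ≤ k
  Nb : ℝ → Fin n → Finset (Fin n)
  Ld : ℝ → Fin n → Finset (Fin k)
  A : Fin n → Fin n → (Fin n → EuclideanSpace ℝ (Fin d)) →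
    (Fin k → EuclideanSpace ℝ (Fin d)) → ℝ → ℝ
  B : Fin n → Fin k → (Fin n → EuclideanSpace ℝ (Fin d)) →
    (Fin k → EuclideanSpace ℝ (Fin d)) → ℝ → ℝ
  τD : ℝ
  aLo : ℝ
  aHi : ℝ
  bLo : ℝ
  τD_pos : 0 < τD
  aLo_pos : 0 < aLo
  bLo_pos : 0 < bLo
  A_bdd : ∀ i j xv yv t, aLo ≤ A i j xv yv t ∧ A i j xv yv t ≤ aHi
  B_bdd : ∀ i j xv yv t, bLo ≤ B i j xv yv t
  A_cont : ∀ i j, Continuous fun p :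
    (Fin n → EuclideanSpace ℝ (Fin d)) × (Fin k → EuclideanSpace ℝ (Fin d)) × ℝ =>
    A i j p.1 p.2.1 p.2.2
  B_cont : ∀ i j, Continuous fun p :
    (Fin n → EuclideanSpace ℝ (Fin d)) × (Fin k → EuclideanSpace ℝ (Fin d)) × ℝ =>
    B i j p.1 p.2.1 p.2.2
  /-- The topology is piecewise constant with consecutive switching instants
  separated by at least the dwell time `τD` (Assumption 1). -/
  dwell : ∃ s : ℕ → ℝ, s 0 = 0 ∧ (∀ m : ℕ, s m + τD ≤ s (m + 1)) ∧
    ∀ m : ℕ, ∀ t₁ ∈ Set.Ico (s m) (s (m + 1)), ∀ t₂ ∈ Set.Ico (s m) (s (m + 1)),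
      Nb t₁ = Nb t₂ ∧ Ld t₁ = Ld t₂

namespace MASData

variable {d n k : ℕ}

/-- The arc relation of the communication graph at time `t`, on the node set
`Fin k ⊕ Fin n` (leaders ⊕ followers).  `arcAt t v v'` means there is an arc
leaving `v` and entering `v'`; there are no arcs from followers into leaders. -/
def arcAt (D : MASData d n k) (t : ℝ) (v v' : Fin k ⊕ Fin n) : Prop :=
  match v, v' with
  | Sum.inl j, Sum.inr i => j ∈ D.Ld t i
  | Sum.inr j, Sum.inr i => j ∈ D.Nb t i
  | _, _ => False

/-- Arc relation of the union graph over the set of times `T`. -/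
def arcOn (D : MASData d n k) (T : Set ℝ) (v v' : Fin k ⊕ Fin n) : Prop :=
  ∃ t ∈ T, D.arcAt t v v'

/-- The union graph over the set of times `T` is L-connected: every follower is
reachable from some leader by a directed path. -/
def LConnectedOn (D : MASData d n k) (T : Set ℝ) : Prop :=
  ∀ i : Fin n, ∃ j : Fin k, Relation.ReflTransGen (D.arcOn T) (Sum.inl j) (Sum.inr i)

/-- Uniformly jointly L-connected. -/
def UJLC (D : MASData d n k) : Prop :=
  ∃ T > (0:ℝ), ∀ t ≥ (0:ℝ), D.LConnectedOn (Set.Ico t (t + T))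

/-- Jointly L-connected. -/
def JLC (D : MASData d n k) : Prop :=
  ∀ t ≥ (0:ℝ), D.LConnectedOn (Set.Ici t)

end MASData

/-- A solution (trajectory) of system (5) together with its inputs: leader
controls `u`, disturbances `w`, follower states `x` and leader states `y`;
the dynamics hold in the sense of right derivatives for `t ≥ 0`, and the
(piecewise continuous) inputs are locally interval integrable along the
solution. -/
structure MASSol {d n k : ℕ} (D : MASData d n k) where
  x : ℝ → Fin n → EuclideanSpace ℝ (Fin d)
  y : ℝ → Fin k → EuclideanSpace ℝ (Fin d)
  u : Fin k → (Fin k → EuclideanSpace ℝ (Fin d)) → ℝ → EuclideanSpace ℝ (Fin d)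
  w : Fin n → ℝ → EuclideanSpace ℝ (Fin d)
  u_cont : ∀ j t, Continuous fun yv => u j yv t
  w_cont : ∀ i, Continuous (w i)
  x_cont : ∀ i, Continuous fun t => x t i
  y_cont : ∀ j, Continuous fun t => y t j
  dyn_y : ∀ (j : Fin k), ∀ t ≥ (0:ℝ),
    HasDerivWithinAt (fun s => y s j) (u j (y t) t) (Set.Ici t) t
  dyn_x : ∀ (i : Fin n), ∀ t ≥ (0:ℝ),
    HasDerivWithinAt (fun s => x s i)
      ((∑ j ∈ D.Nb t i, D.A i j (x t) (y t) t • (x t j - x t i)) +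
        (∑ j ∈ D.Ld t i, D.B i j (x t) (y t) t • (y t j - x t i)) + w i t)
      (Set.Ici t) t
  r_int : ∀ a b : ℝ, IntervalIntegrable (fun t => ⨆ j : Fin k, ‖u j (y t) t‖)
    MeasureTheory.volume a b
  q_int : ∀ a b : ℝ, IntervalIntegrable
    (fun t => (⨆ j : Fin k, ‖u j (y t) t‖) + ⨆ i : Fin n, ‖w i t‖)
    MeasureTheory.volume a b
  z_int : ∀ a b : ℝ, IntervalIntegrable
    (fun t => Real.sqrt ((∑ j : Fin k, ‖u j (y t) t‖ ^ 2) + ∑ i : Fin n, ‖w i t‖ ^ 2))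
    MeasureTheory.volume a b

namespace MASSol

variable {d n k : ℕ} {D : MASData d n k}

/-- The moving multi-leader set `ℒ(y(t))`: the convex hull of the leaders. -/
def Lset (sol : MASSol D) (t : ℝ) : Set (EuclideanSpace ℝ (Fin d)) :=
  convexHull ℝ (Set.range (sol.y t))

/-- `|x(t)|_{ℒ(y(t))}`: the maximal distance of the followers from `ℒ(y(t))`. -/
def distL (sol : MASSol D) (t : ℝ) : ℝ :=
  ⨆ i : Fin n, Metric.infDist (sol.x t i) (sol.Lset t)

/-- `r(t) = max_j |u_j(y(t),t)|`. -/
def rmax (sol : MASSol D) (t : ℝ) : ℝ := ⨆ j : Fin k, ‖sol.u j (sol.y t) t‖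

/-- `q(t) = max_j |u_j(y(t),t)| + max_i |w_i(t)|`. -/
def qmax (sol : MASSol D) (t : ℝ) : ℝ := sol.rmax t + ⨆ i : Fin n, ‖sol.w i t‖

/-- `|z(t)|`: the Euclidean norm of the combined input `z = (u, w)` at time `t`. -/
def znorm (sol : MASSol D) (t : ℝ) : ℝ :=
  Real.sqrt ((∑ j : Fin k, ‖sol.u j (sol.y t) t‖ ^ 2) + ∑ i : Fin n, ‖sol.w i t‖ ^ 2)

/-- `‖z‖_∞ = sup_{t ≥ 0} |z(t)|`. -/
def zsup (sol : MASSol D) : ℝ := sSup (sol.znorm '' Set.Ici 0)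

/-- The combined input `z` is (essentially) bounded, i.e. `z ∈ L_∞`. -/
def zBounded (sol : MASSol D) : Prop := BddAbove (sol.znorm '' Set.Ici 0)

end MASSol

/-- Class-𝒦 function on `[0,∞)`. -/
def IsClassK (γ : ℝ → ℝ) : Prop :=
  ContinuousOn γ (Set.Ici 0) ∧ StrictMonoOn γ (Set.Ici 0) ∧ γ 0 = 0

/-- Class-𝒦𝓛 function. -/
def IsClassKL (β : ℝ → ℝ → ℝ) : Prop :=
  (∀ t ≥ (0:ℝ), IsClassK fun s => β s t) ∧
  (∀ s ≥ (0:ℝ), AntitoneOn (fun t => β s t) (Set.Ici 0) ∧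
    Filter.Tendsto (fun t => β s t) Filter.atTop (nhds 0))

/-- System (5) is (generalized) set input-to-state stable with respect to
`ℒ(y(t))` with input `z`. -/
def MASData.SISS {d n k : ℕ} (D : MASData d n k) : Prop :=
  ∃ β γ, IsClassKL β ∧ IsClassK γ ∧
    ∀ sol : MASSol D, sol.zBounded →
      ∀ t ≥ (0:ℝ), sol.distL t ≤ β (sol.distL 0) t + γ sol.zsup

/-- System (5) is (generalized) set integral-input-to-state stable with respect
to `ℒ(y(t))`. -/
def MASData.SiISS {d n k : ℕ} (D : MASData d n k) : Prop :=
  ∃ β γ, IsClassKL β ∧ IsClassK γ ∧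
    ∀ sol : MASSol D, ∀ t ≥ (0:ℝ),
      sol.distL t ≤ β (sol.distL 0) t + ∫ s in (0:ℝ)..t, γ (sol.znorm s)

/-- The upper Dini derivative `D⁺h(t) = limsup_{s→0⁺} (h(t+s) − h(t))/s`. -/
def upperDini (h : ℝ → ℝ) (t : ℝ) : ℝ :=
  Filter.limsup (fun s => (h (t + s) - h t) / s) (nhdsWithin 0 (Set.Ioi 0))

/-- The distance to a nonempty convex set is a convex function. -/
theorem Convex.convexOn_infDist {E : Type*} [NormedAddCommGroup E] [NormedSpace ℝ E] {C : Set E}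
    (hC : Convex ℝ C) (hne : C.Nonempty) : ConvexOn ℝ univ fun p => infDist p C := by
  refine ⟨convex_univ, fun p _ q _ a b ha hb hab => le_of_forall_pos_le_add fun ε hε => ?_⟩
  obtain ⟨p', hp', hp⟩ := (infDist_lt_iff hne).1 (lt_add_of_pos_right (infDist p C) hε)
  obtain ⟨q', hq', hq⟩ := (infDist_lt_iff hne).1 (lt_add_of_pos_right (infDist q C) hε)
  calc infDist (a • p + b • q) C
      ≤ dist (a • p + b • q) (a • p' + b • q') := infDist_le_dist_of_mem (hC hp' hq' ha hb hab)
    _ ≤ dist (a • p) (a • p') + dist (b • q) (b • q') := dist_add_add_le _ _ _ _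
    _ = a * dist p p' + b * dist q q' := by
        rw [dist_smul₀, dist_smul₀, Real.norm_of_nonneg ha, Real.norm_of_nonneg hb]
    _ ≤ a * (infDist p C + ε) + b * (infDist q C + ε) := by gcongr
    _ = a • infDist p C + b • infDist q C + ε := by
        simp only [smul_eq_mul]; linear_combination ε * hab

/-- A convex function decreases along a nonnegative combination of directions at least as fast as
the corresponding combination of its increments. -/
theorem ConvexOn.map_add_sum_smul_sub_le {E ι : Type*} [AddCommGroup E] [Module ℝ E] {f : E → ℝ}
    (hf : ConvexOn ℝ univ f) (s : Finset ι) (c : ι → ℝ) (p : ι → E) (q : E)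
    (hc : ∀ j ∈ s, 0 ≤ c j) (hs : ∑ j ∈ s, c j ≤ 1) :
    f (q + ∑ j ∈ s, c j • (p j - q)) ≤ f q + ∑ j ∈ s, c j * (f (p j) - f q) := by
  have h := hf.map_add_sum_le (t := s) (w := c) (p := p) (v := 1 - ∑ j ∈ s, c j) (q := q) hc
    (by ring) (fun _ _ => mem_univ _) (by linarith) (mem_univ _)
  have e : (1 - ∑ j ∈ s, c j) • q + ∑ j ∈ s, c j • p j = q + ∑ j ∈ s, c j • (p j - q) := by
    simp only [smul_sub, Finset.sum_sub_distrib, ← Finset.sum_smul]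
    module
  rw [e] at h
  refine h.trans_eq ?_
  simp only [mul_sub, Finset.sum_sub_distrib, ← Finset.sum_mul, smul_eq_mul]
  ring

/-- The distance to the convex hull of a finite family is 1-Lipschitz in the family. -/
theorem infDist_convexHull_range_le {E ι : Type*} [NormedAddCommGroup E] [NormedSpace ℝ E]
    [Fintype ι] [Nonempty ι] (p : E) (y y' : ι → E) :
    infDist p (convexHull ℝ (range y')) ≤ infDist p (convexHull ℝ (range y)) + ‖y' - y‖ := by
  have hne : ∀ v : ι → E, (convexHull ℝ (range v)).Nonempty := fun v =>
    (range_nonempty v).convexHull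
  have hsub : convexHull ℝ (range y) ⊆
      {q ∈ univ | infDist q (convexHull ℝ (range y')) ≤ ‖y' - y‖} := by
    refine convexHull_min ?_ (((convex_convexHull ℝ _).convexOn_infDist (hne y')).convex_le _)
    rintro _ ⟨j, rfl⟩
    refine ⟨mem_univ _, (infDist_le_dist_of_mem (subset_convexHull ℝ _ (mem_range_self j))).trans ?_⟩
    rw [dist_comm, dist_eq_norm]
    exact norm_le_pi_norm (y' - y) j
  rw [← sub_le_iff_le_add]
  refine (le_infDist (hne y)).2 fun q hq => ?_
  have := (hsub hq).2
  have := infDist_le_infDist_add_dist (s := convexHull ℝ (range y')) (x := p) (y := q)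
  linarith

/-- An integrable function has a continuous almost-primitive whose lower right slopes
dominate it at *every* point. -/
theorem exists_continuousOn_forall_eventually_mul_le_sub {f : ℝ → ℝ} {a b ε : ℝ} (hab : a ≤ b)
    (hf : IntervalIntegrable f volume a b) (hf0 : ∀ t, 0 ≤ f t) (hε : 0 < ε) :
    ∃ W : ℝ → ℝ, ContinuousOn W (Icc a b) ∧ W a = 0 ∧ (∀ t ∈ Icc a b, 0 ≤ W t) ∧
      (∀ t ∈ Icc a b, W t ≤ (∫ s in a..b, f s) + ε) ∧
      ∀ t ∈ Ico a b, ∀ᶠ s in nhdsWithin t (Ioi t), (s - t) * f t ≤ W s - W t := by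
  have hfI : IntegrableOn f (Icc a b) := by
    rwa [integrableOn_Icc_iff_integrableOn_Ioc, ← intervalIntegrable_iff_integrableOn_Ioc_of_le hab]
  obtain ⟨G, f_lt_G, Gcont, Gint, G_lt_top, hG⟩ :=
    exists_lt_lowerSemicontinuous_integral_lt f hfI hε
  have Gii : ∀ {c d}, c ∈ Icc a b → d ∈ Icc a b →
      IntervalIntegrable (fun x => (G x).toReal) volume c d := fun hc hd =>
    (IntegrableOn.mono_set Gint (by
      simpa using uIcc_subset_Icc hc hd)).intervalIntegrable
  have G0 : ∀ x, 0 ≤ (G x).toReal := fun x =>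
    EReal.toReal_nonneg ((EReal.coe_nonneg.2 (hf0 x)).trans (f_lt_G x).le)
  have ha : a ∈ Icc a b := left_mem_Icc.2 hab
  refine ⟨fun t => ∫ s in a..t, (G s).toReal, ?_, by simp,
    fun t ht => intervalIntegral.integral_nonneg ht.1 fun s _ => G0 s, fun t ht => ?_,
    fun t ht => ?_⟩
  · rw [← uIcc_of_le hab] at Gint ⊢
    exact intervalIntegral.continuousOn_primitive_interval Gint
  · calc ∫ s in a..t, (G s).toReal ≤ ∫ s in a..b, (G s).toReal :=
          intervalIntegral.integral_mono_interval le_rfl ht.1 ht.2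
            (Eventually.of_forall G0) (Gii ha (right_mem_Icc.2 hab))
      _ ≤ (∫ s in a..b, f s) + ε := by
          rw [intervalIntegral.integral_of_le hab, intervalIntegral.integral_of_le hab,
            ← integral_Icc_eq_integral_Ioc, ← integral_Icc_eq_integral_Ioc]
          exact hG.le
  · obtain ⟨m, M, hmM, H⟩ := mem_nhds_iff_exists_Ioo_subset.1
      (Gcont.lowerSemicontinuousAt t _ (f_lt_G t))
    filter_upwards [Ioo_mem_nhdsGT (lt_min hmM.2 ht.2)] with u hu
    have hub : u ∈ Icc a b := ⟨ht.1.trans hu.1.le, (hu.2.trans_le (min_le_right _ _)).le⟩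
    rw [intervalIntegral.integral_interval_sub_left (Gii ha hub) (Gii ha ⟨ht.1, ht.2.le⟩)]
    calc (u - t) * f t = ∫ _ in t..u, f t := by simp
      _ ≤ ∫ s in t..u, (G s).toReal := by
        refine intervalIntegral.integral_mono_ae_restrict hu.1.le (by simp)
          (Gii ⟨ht.1, ht.2.le⟩ hub) ?_
        have C1 : ∀ᵐ x ∂volume.restrict (Icc t u), G x < ⊤ :=
          ae_mono (Measure.restrict_mono (Icc_subset_Icc ht.1 hub.2) le_rfl) G_lt_top
        filter_upwards [C1, ae_restrict_mem measurableSet_Icc] with x hxt hx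
        have hxm : (f t : EReal) < G x :=
          H ⟨hmM.1.trans_le hx.1, (hx.2.trans_lt hu.2).trans_le (min_le_left _ _)⟩
        rw [← EReal.coe_le_coe_iff, EReal.coe_toReal hxt.ne (f_lt_G x).ne_bot]
        exact hxm.le

theorem frequently_slope_lt {f : ℝ → ℝ} {t ρ r : ℝ} (hρ : ρ < r)
    (h : ∀ᶠ s in nhdsWithin t (Ioi t), f s ≤ f t + (s - t) * ρ) :
    ∃ᶠ s in nhdsWithin t (Ioi t), slope f t s < r := by
  refine Eventually.frequently ?_
  filter_upwards [h, self_mem_nhdsWithin] with s hs hts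
  have hst : 0 < s - t := sub_pos.2 hts
  rw [slope_def_field, div_lt_iff₀ hst]
  nlinarith

/-- The solution of `φ' = α (δ - φ) + β (1 - φ)` with `φ 0 = 1`. -/
theorem exists_strictAnti_hasDerivAt_decay {α β δ : ℝ} (hα : 0 < α) (hβ : 0 ≤ β) (hδ : δ < 1) :
    ∃ φ : ℝ → ℝ, StrictAnti φ ∧ φ 0 = 1 ∧ (∀ s, δ ≤ φ s) ∧
      ∀ s, HasDerivAt φ (α * (δ - φ s) + β * (1 - φ s)) s := by
  have hαβ : 0 < α + β := by linarith
  set θ := (α * δ + β) / (α + β) with hθ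
  have hθ' : θ * (α + β) = α * δ + β := div_mul_cancel₀ _ hαβ.ne'
  have hθ1 : 0 < 1 - θ := by
    rw [hθ, sub_pos, div_lt_one hαβ]
    nlinarith
  have hδθ : δ ≤ θ := by
    rw [hθ, le_div_iff₀ hαβ]
    nlinarith
  refine ⟨fun s => θ + (1 - θ) * Real.exp (-(α + β) * s), fun s t hst => ?_, by simp,
    fun s => ?_, fun s => ?_⟩
  · have : -(α + β) * t < -(α + β) * s := by nlinarith
    have := Real.exp_lt_exp.2 this
    dsimp only
    gcongr
  · have := mul_pos hθ1 (Real.exp_pos (-(α + β) * s))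
    dsimp only
    linarith
  · have h := ((((hasDerivAt_id s).const_mul (-(α + β))).exp).const_mul (1 - θ)).const_add θ
    refine h.congr_deriv ?_
    simp only [id]
    linear_combination hθ'

namespace MASSol

variable {d n k : ℕ} {D : MASData d n k} (sol : MASSol D)

/-- The distance of follower `i` from the convex hull of the leaders. -/
def followerDist (i : Fin n) (t : ℝ) : ℝ := infDist (sol.x t i) (sol.Lset t)

theorem znorm_nonneg (t : ℝ) : 0 ≤ sol.znorm t := Real.sqrt_nonneg _

theorem infDist_Lset_le (p : EuclideanSpace ℝ (Fin d)) (s t : ℝ) :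
    infDist p (sol.Lset s) ≤ infDist p (sol.Lset t) + ‖sol.y s - sol.y t‖ :=
  have : Nonempty (Fin k) := ⟨⟨0, D.hk⟩⟩
  infDist_convexHull_range_le p _ _

theorem continuous_followerDist (i : Fin n) : Continuous (sol.followerDist i) := by
  have hy : Continuous sol.y := continuous_pi sol.y_cont
  refine continuous_iff_continuousAt.2 fun t => tendsto_iff_dist_tendsto_zero.2 ?_
  have h0 : Tendsto (fun s => dist (sol.x s i) (sol.x t i) + ‖sol.y s - sol.y t‖) (nhds t)
      (nhds 0) := by
    have : Continuous fun s => dist (sol.x s i) (sol.x t i) + ‖sol.y s - sol.y t‖ :=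
      ((sol.x_cont i).dist continuous_const).add (hy.sub continuous_const).norm
    simpa using this.tendsto t
  refine squeeze_zero (fun _ => dist_nonneg) (fun s => ?_) h0
  rw [Real.dist_eq, abs_sub_le_iff]
  unfold followerDist
  have h1 := sol.infDist_Lset_le (sol.x s i) s t
  have h2 := sol.infDist_Lset_le (sol.x t i) t s
  have h3 := infDist_le_infDist_add_dist (s := sol.Lset t) (x := sol.x s i) (y := sol.x t i)
  have h4 := infDist_le_infDist_add_dist (s := sol.Lset s) (x := sol.x t i) (y := sol.x s i)
  rw [dist_comm] at h4
  rw [norm_sub_rev] at h2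
  constructor <;> linarith

theorem followerDist_le_distL (i : Fin n) (t : ℝ) : sol.followerDist i t ≤ sol.distL t :=
  le_ciSup (f := fun i => sol.followerDist i t) (finite_range _).bddAbove i

theorem distL_nonneg (t : ℝ) : 0 ≤ sol.distL t := Real.iSup_nonneg fun _ => infDist_nonneg

theorem norm_input_add_norm_disturbance_le (i : Fin n) (t : ℝ) :
    ‖fun j => sol.u j (sol.y t) t‖ + ‖sol.w i t‖ ≤ Real.sqrt 2 * sol.znorm t := by
  have hU0 : 0 ≤ ∑ j, ‖sol.u j (sol.y t) t‖ ^ 2 := by positivity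
  have hU : ‖fun j => sol.u j (sol.y t) t‖ ≤ Real.sqrt (∑ j, ‖sol.u j (sol.y t) t‖ ^ 2) :=
    (pi_norm_le_iff_of_nonneg (Real.sqrt_nonneg _)).2 fun j => Real.le_sqrt_of_sq_le
      (Finset.single_le_sum (f := fun j => ‖sol.u j (sol.y t) t‖ ^ 2)
        (fun _ _ => by positivity) (Finset.mem_univ j))
  have hw : ‖sol.w i t‖ ^ 2 ≤ ∑ i, ‖sol.w i t‖ ^ 2 :=
    Finset.single_le_sum (f := fun i => ‖sol.w i t‖ ^ 2)
        (fun _ _ => by positivity) (Finset.mem_univ i)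
  have hU2 := pow_le_pow_left₀ (norm_nonneg _) hU 2
  rw [Real.sq_sqrt hU0] at hU2
  rw [znorm, ← Real.sqrt_mul (by norm_num)]
  refine Real.le_sqrt_of_sq_le ?_
  nlinarith [sq_nonneg (‖fun j => sol.u j (sol.y t) t‖ - ‖sol.w i t‖)]

/-- Right Dini estimate for the distance of a follower from the moving leader set. -/
theorem eventually_followerDist_le (i : Fin n) {t ε : ℝ} (ht : 0 ≤ t) (hε : 0 < ε) :
    ∀ᶠ s in nhdsWithin t (Ioi t), sol.followerDist i s ≤ sol.followerDist i t + (s - t) *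
      (∑ j ∈ D.Nb t i, D.A i j (sol.x t) (sol.y t) t *
        (sol.followerDist j t - sol.followerDist i t) + Real.sqrt 2 * sol.znorm t + ε) := by
  have hdy : HasDerivWithinAt sol.y (fun j => sol.u j (sol.y t) t) (Ici t) t :=
    hasDerivWithinAt_pi.2 fun j => sol.dyn_y j t ht
  have hY := (hasDerivWithinAt_iff_isLittleO.1 hdy.Ioi_of_Ici).def (half_pos hε)
  have hX := (hasDerivWithinAt_iff_isLittleO.1 (sol.dyn_x i t ht).Ioi_of_Ici).def (half_pos hε)
  set U : Fin k → EuclideanSpace ℝ (Fin d) := fun j => sol.u j (sol.y t) t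
  let idx := (D.Nb t i).disjSum (D.Ld t i)
  let c : Fin n ⊕ Fin k → ℝ := Sum.elim (fun j => D.A i j (sol.x t) (sol.y t) t)
    fun j => D.B i j (sol.x t) (sol.y t) t
  let p : Fin n ⊕ Fin k → EuclideanSpace ℝ (Fin d) := Sum.elim (sol.x t) (sol.y t)
  have hc : ∀ j, 0 ≤ c j := by
    rintro (j | j)
    · exact D.aLo_pos.le.trans (D.A_bdd _ _ _ _ _).1
    · exact D.bLo_pos.le.trans (D.B_bdd _ _ _ _ _)
  have hsmall : ∀ᶠ s in nhdsWithin t (Ioi t), (s - t) * ∑ j ∈ idx, c j ≤ 1 := by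
    have : Tendsto (fun s => (s - t) * ∑ j ∈ idx, c j) (nhdsWithin t (Ioi t)) (nhds 0) := by
      have h : Continuous fun s => (s - t) * ∑ j ∈ idx, c j := by fun_prop
      simpa using (h.tendsto t).mono_left nhdsWithin_le_nhds
    exact this.eventually_le_const one_pos
  filter_upwards [hX, hY, hsmall, self_mem_nhdsWithin] with s hXs hYs hs hts
  have hst : 0 < s - t := sub_pos.2 hts
  have hne : (sol.Lset t).Nonempty :=
    have : Nonempty (Fin k) := ⟨⟨0, D.hk⟩⟩
    (range_nonempty (sol.y t)).convexHull
  have hconv := ((convex_convexHull ℝ _).convexOn_infDist hne).map_add_sum_smul_sub_le idx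
    (fun j => (s - t) * c j) p (sol.x t i) (fun j _ => mul_nonneg hst.le (hc j))
    (by rwa [← Finset.mul_sum])
  set q := sol.x t i + ∑ j ∈ idx, ((s - t) * c j) • (p j - sol.x t i) with hq
  have hB : ∑ j ∈ D.Ld t i, (s - t) * D.B i j (sol.x t) (sol.y t) t *
      (infDist (sol.y t j) (sol.Lset t) - infDist (sol.x t i) (sol.Lset t)) ≤ 0 := by
    refine Finset.sum_nonpos fun j _ => mul_nonpos_of_nonneg_of_nonpos
      (mul_nonneg hst.le (hc (Sum.inr j))) ?_
    rw [infDist_zero_of_mem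
      (show sol.y t j ∈ sol.Lset t from subset_convexHull ℝ _ (mem_range_self j)), zero_sub]
    exact neg_nonpos.2 infDist_nonneg
  have hA : infDist q (sol.Lset t) ≤ sol.followerDist i t + (s - t) *
      ∑ j ∈ D.Nb t i, D.A i j (sol.x t) (sol.y t) t *
        (sol.followerDist j t - sol.followerDist i t) := by
    refine hconv.trans ?_
    simp only [Finset.mul_sum, ← mul_assoc]
    exact add_le_add_right
      ((Finset.sum_disjSum _ _ _).trans_le (add_le_of_nonpos_right hB)) _
  have hxq : dist (sol.x s i) q ≤ (s - t) * (‖sol.w i t‖ + ε / 2) := by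
    have e : sol.x s i - q = (sol.x s i - sol.x t i - (s - t) •
        ((∑ j ∈ D.Nb t i, D.A i j (sol.x t) (sol.y t) t • (sol.x t j - sol.x t i)) +
          (∑ j ∈ D.Ld t i, D.B i j (sol.x t) (sol.y t) t • (sol.y t j - sol.x t i)) +
          sol.w i t)) + (s - t) • sol.w i t := by
      simp only [hq, idx, c, p, Finset.sum_disjSum, Sum.elim_inl, Sum.elim_inr, mul_smul,
        ← Finset.smul_sum]
      module
    rw [dist_eq_norm, e]
    refine (norm_add_le_of_le hXs le_rfl).trans_eq ?_
    rw [norm_smul, Real.norm_of_nonneg hst.le]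
    ring
  have hys : ‖sol.y s - sol.y t‖ ≤ (s - t) * (‖U‖ + ε / 2) := by
    have e : sol.y s - sol.y t = (sol.y s - sol.y t - (s - t) • U) + (s - t) • U := by abel
    rw [e]
    refine (norm_add_le_of_le hYs le_rfl).trans_eq ?_
    rw [norm_smul, Real.norm_of_nonneg hst.le]
    ring
  have h1 := sol.infDist_Lset_le (sol.x s i) s t
  have h2 := infDist_le_infDist_add_dist (s := sol.Lset t) (x := sol.x s i) (y := q)
  have h3 := mul_le_mul_of_nonneg_left (sol.norm_input_add_norm_disturbance_le i t) hst.le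
  change infDist _ _ ≤ _
  linarith

theorem continuous_distL : Continuous sol.distL := by
  have : Nonempty (Fin n) := ⟨⟨0, by have := D.hn; omega⟩⟩
  have h : sol.distL = fun t => Finset.univ.sup' Finset.univ_nonempty
      fun i => sol.followerDist i t := by
    funext t
    exact (Finset.sup'_univ_eq_ciSup _).symm
  rw [h]
  exact Continuous.finset_sup'_apply _ fun i _ => sol.continuous_followerDist i

/-- The maximal distance to the leader set grows at most at rate `√2 |z|`. -/
theorem distL_le_of_slope_le {W : ℝ → ℝ} {a b : ℝ} (ha : 0 ≤ a) (hW : ContinuousOn W (Icc a b))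
    (hWa : W a = 0)
    (hWz : ∀ t ∈ Ico a b, ∀ᶠ s in nhdsWithin t (Ioi t), (s - t) * sol.znorm t ≤ W s - W t) :
    ∀ t ∈ Icc a b, sol.distL t ≤ sol.distL a + Real.sqrt 2 * W t := by
  have : Nonempty (Fin n) := ⟨⟨0, by have := D.hn; omega⟩⟩
  have key := image_le_of_liminf_slope_right_le_deriv_boundary (a := a) (b := b)
    (f := fun t => sol.distL t - Real.sqrt 2 * W t) (B := fun _ => sol.distL a) (B' := fun _ => 0)
    (sol.continuous_distL.continuousOn.sub (continuousOn_const.mul hW)) (by simp [hWa])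
    continuousOn_const (fun _ _ => hasDerivWithinAt_const _ _ _) fun t ht r hr => ?_
  · exact fun t ht => by linarith [key ht]
  refine frequently_slope_lt (half_lt_self hr) ?_
  have ht0 : 0 ≤ t := ha.trans ht.1
  let S : Fin n → ℝ := fun i => ∑ j ∈ D.Nb t i, D.A i j (sol.x t) (sol.y t) t
  have hsmall : ∀ i, ∀ᶠ s in nhdsWithin t (Ioi t), (s - t) * S i ≤ 1 := fun i => by
    have : Tendsto (fun s => (s - t) * S i) (nhdsWithin t (Ioi t)) (nhds 0) := by
      have h : Continuous fun s => (s - t) * S i := by fun_prop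
      simpa using (h.tendsto t).mono_left nhdsWithin_le_nhds
    exact this.eventually_le_const one_pos
  filter_upwards [eventually_all.2 fun i => sol.eventually_followerDist_le i ht0 (half_pos hr),
    eventually_all.2 hsmall, hWz t ht, self_mem_nhdsWithin] with s hs hsS hsW hts
  have hst : 0 < s - t := sub_pos.2 hts
  have hmax : sol.distL s ≤
      sol.distL t + (s - t) * (Real.sqrt 2 * sol.znorm t + r / 2) := by
    refine ciSup_le fun i => (hs i).trans ?_
    have hsum : ∑ j ∈ D.Nb t i, D.A i j (sol.x t) (sol.y t) t *
        (sol.followerDist j t - sol.followerDist i t) ≤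
        S i * (sol.distL t - sol.followerDist i t) := by
      rw [Finset.sum_mul]
      refine Finset.sum_le_sum fun j _ => mul_le_mul_of_nonneg_left
        (sub_le_sub_right (sol.followerDist_le_distL j t) _) ?_
      exact D.aLo_pos.le.trans (D.A_bdd _ _ _ _ _).1
    have h1 := mul_le_mul_of_nonneg_left hsum hst.le
    have h2 := mul_le_mul_of_nonneg_right (hsS i)
      (sub_nonneg.2 (sol.followerDist_le_distL i t))
    linarith
  have h2 := mul_le_mul_of_nonneg_left hsW (Real.sqrt_nonneg 2)
  linarith

/-- A follower `m` with a persistent in-arc from a follower `i` that stays close to the leader set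
is attracted to the leader set at the rate of the decay profile `φ`. -/
theorem followerDist_le_of_arc {φ W : ℝ → ℝ} {a b δ c₀ ε : ℝ} {i m : Fin n} (ha : 0 ≤ a)
    (hφ0 : φ 0 = 1) (hφ1 : ∀ s, 0 ≤ s → φ s ≤ 1) (hδφ : ∀ s, δ ≤ φ s)
    (hφ : ∀ s, HasDerivAt φ (D.aLo * (δ - φ s) + n * D.aHi * (1 - φ s)) s)
    (hW : ContinuousOn W (Icc a b)) (hWa : W a = 0)
    (hWz : ∀ t ∈ Ico a b, ∀ᶠ s in nhdsWithin t (Ioi t), (s - t) * sol.znorm t ≤ W s - W t)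
    (hc₀ : 0 ≤ c₀) (hW0 : ∀ t ∈ Icc a b, 0 ≤ W t) (hε : 0 < ε)
    (harc : ∀ t ∈ Ico a b, i ∈ D.Nb t m)
    (hi : ∀ t ∈ Ico a b, sol.followerDist i t ≤ δ * sol.distL a + c₀) :
    ∀ t ∈ Icc a b, sol.followerDist m t ≤
      φ (t - a) * sol.distL a + c₀ + Real.sqrt 2 * W t + ε * (t - a) := by
  set M := sol.distL a with hM
  have hM0 : 0 ≤ M := sol.distL_nonneg a
  have hmax := sol.distL_le_of_slope_le ha hW hWa hWz
  have haHi : 0 ≤ D.aHi := D.aLo_pos.le.trans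
    ((D.A_bdd m m (sol.x a) (sol.y a) a).1.trans (D.A_bdd m m (sol.x a) (sol.y a) a).2)
  let A : ℝ → Fin n → ℝ := fun t j => D.A m j (sol.x t) (sol.y t) t
  have key := image_le_of_liminf_slope_right_lt_deriv_boundary (a := a) (b := b)
    (f := fun t => sol.followerDist m t - Real.sqrt 2 * W t - c₀)
    (f' := fun t => ∑ j ∈ D.Nb t m, A t j * (sol.followerDist j t - sol.followerDist m t))
    (B := fun t => φ (t - a) * M + ε * (t - a))
    (B' := fun t => (D.aLo * (δ - φ (t - a)) + n * D.aHi * (1 - φ (t - a))) * M + ε)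
    (((sol.continuous_followerDist m).continuousOn.sub (continuousOn_const.mul hW)).sub
      continuousOn_const) (fun t ht r hr => ?_) ?_ (fun t => ?_) fun t ht hv => ?_
  · exact fun t ht => by linarith [key ht]
  · obtain ⟨ρ, hρ, hρr⟩ := exists_between hr
    refine frequently_slope_lt hρr ?_
    filter_upwards [sol.eventually_followerDist_le m (ha.trans ht.1) (sub_pos.2 hρ), hWz t ht]
      with s hs hsW
    have h2 := mul_le_mul_of_nonneg_left hsW (Real.sqrt_nonneg 2)
    simp only [A] at hs ⊢
    linarith
  · have := sol.followerDist_le_distL m a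
    simp only [hWa, sub_self, hφ0]
    linarith
  · have h1 := ((hφ (t - a)).comp_sub_const t a).mul_const M
    have h2 := ((hasDerivAt_id t).sub_const a).const_mul ε
    exact (h1.add h2).congr_deriv (by rw [mul_one])
  · have hta : 0 ≤ t - a := sub_nonneg.2 ht.1
    have htI := Ico_subset_Icc_self ht
    have hφt := hφ1 _ hta
    have hη : 0 ≤ ε * (t - a) := mul_nonneg hε.le hta
    have hWt : 0 ≤ Real.sqrt 2 * W t := mul_nonneg (Real.sqrt_nonneg 2) (hW0 t htI)
    have hA0 : ∀ j, D.aLo ≤ A t j := fun j => (D.A_bdd _ _ _ _ _).1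
    have hA1 : ∀ j, A t j ≤ D.aHi := fun j => (D.A_bdd _ _ _ _ _).2
    have hclose : A t i * (sol.followerDist i t - sol.followerDist m t) ≤
        D.aLo * ((δ - φ (t - a)) * M) := by
      have h1 : sol.followerDist i t - sol.followerDist m t ≤ (δ - φ (t - a)) * M := by
        linarith [hi t ht]
      have h2 : (δ - φ (t - a)) * M ≤ 0 :=
        mul_nonpos_of_nonpos_of_nonneg (by linarith [hδφ (t - a)]) hM0
      exact (mul_le_mul_of_nonneg_left h1 (D.aLo_pos.le.trans (hA0 i))).trans
        (mul_le_mul_of_nonpos_right (hA0 i) h2)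
    have hothers : ∑ j ∈ (D.Nb t m).erase i,
        A t j * (sol.followerDist j t - sol.followerDist m t) ≤
        n * (D.aHi * ((1 - φ (t - a)) * M)) := by
      have hnn : 0 ≤ (1 - φ (t - a)) * M := mul_nonneg (by linarith) hM0
      have hcard : (((D.Nb t m).erase i).card : ℝ) ≤ n := by
        exact_mod_cast (Finset.card_le_univ _).trans_eq (Fintype.card_fin n)
      calc _ ≤ ((D.Nb t m).erase i).card • (D.aHi * ((1 - φ (t - a)) * M)) := by
            refine Finset.sum_le_card_nsmul _ _ _ fun j _ => ?_
            have h1 : sol.followerDist j t - sol.followerDist m t ≤ (1 - φ (t - a)) * M := by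
              linarith [hmax t htI, sol.followerDist_le_distL j t]
            exact (mul_le_mul_of_nonneg_left h1 (D.aLo_pos.le.trans (hA0 j))).trans
              (mul_le_mul_of_nonneg_right (hA1 j) hnn)
        _ ≤ _ := by
            rw [nsmul_eq_mul]
            exact mul_le_mul_of_nonneg_right hcard (mul_nonneg haHi hnn)
    rw [← Finset.add_sum_erase _ _ (harc t ht)]
    linarith

end MASSol

/-- **Lemma 12.**  Fix `δ₀ ∈ (0,1)`.  There is a strictly decreasing function
`φ_{δ₀} : [0, τ_D] → (0, 1]` with `φ_{δ₀}(0) = 1`, depending only on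
`n, a_*, a^*, τ_D, δ₀`, such that for any system with these constants, any
solution, any arc `(i, m)` between followers present throughout
`[t₀, t₀ + τ_D)`, and any `c̃₀ > 0` with
`dist(x_i(t), ℒ(y(t))) ≤ δ₀·|x(t₀)|_{ℒ(y(t₀))} + c̃₀` on `[t₀, t₀ + τ_D)`,
one has `dist(x_m(t), ℒ(y(t))) ≤ φ_{δ₀}(t−t₀)·|x(t₀)|_{ℒ(y(t₀))} + c̃₀ +
2√2 ∫_{t₀}^{t₀+τ_D} |z(s)| ds` for all `t ∈ [t₀, t₀ + τ_D]`. -/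
theorem lemma12_follower_arc_integral (d n k : ℕ) (τD aLo aHi bLo δ₀ : ℝ)
    (hτ : 0 < τD) (hδ₀ : δ₀ ∈ Set.Ioo (0:ℝ) 1) :
    ∃ φ : ℝ → ℝ,
      StrictAntiOn φ (Set.Icc 0 τD) ∧ φ 0 = 1 ∧
      (∀ s ∈ Set.Icc (0:ℝ) τD, 0 < φ s ∧ φ s ≤ 1) ∧
      ∀ (D : MASData d n k), D.τD = τD → D.aLo = aLo → D.aHi = aHi → D.bLo = bLo →
        ∀ (sol : MASSol D) (t₀ : ℝ), 0 ≤ t₀ → ∀ (i m : Fin n), ∀ c₀ : ℝ, 0 < c₀ →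
          (∀ t ∈ Set.Ico t₀ (t₀ + τD), i ∈ D.Nb t m) →
          (∀ t ∈ Set.Ico t₀ (t₀ + τD),
            Metric.infDist (sol.x t i) (sol.Lset t) ≤ δ₀ * sol.distL t₀ + c₀) →
          ∀ t ∈ Set.Icc t₀ (t₀ + τD),
            Metric.infDist (sol.x t m) (sol.Lset t) ≤
              φ (t - t₀) * sol.distL t₀ + c₀ +
                2 * Real.sqrt 2 * ∫ s in t₀..(t₀ + τD), sol.znorm s := by
  obtain ⟨α, β, hα, hβ, hαβ⟩ : ∃ α β : ℝ, 0 < α ∧ 0 ≤ β ∧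
      (0 < aLo → aLo ≤ aHi → α = aLo ∧ β = n * aHi) := by
    by_cases h : 0 < aLo ∧ aLo ≤ aHi
    · exact ⟨aLo, n * aHi, h.1, mul_nonneg n.cast_nonneg (h.1.le.trans h.2), fun _ _ => ⟨rfl, rfl⟩⟩
    · exact ⟨1, 0, one_pos, le_rfl, fun h1 h2 => absurd ⟨h1, h2⟩ h⟩
  obtain ⟨φ, hanti, hφ0, hδφ, hφ⟩ := exists_strictAnti_hasDerivAt_decay hα hβ hδ₀.2
  have hφ1 : ∀ s, 0 ≤ s → φ s ≤ 1 := fun s hs => hφ0 ▸ hanti.antitone hs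
  refine ⟨φ, hanti.strictAntiOn _, hφ0,
    fun s hs => ⟨hδ₀.1.trans_le (hδφ s), hφ1 s hs.1⟩, ?_⟩
  rintro D - rfl rfl - sol t₀ ht₀ i m c₀ hc₀ harc hi t ht
  obtain ⟨rfl, rfl⟩ := hαβ D.aLo_pos
    ((D.A_bdd m m (sol.x t₀) (sol.y t₀) t₀).1.trans (D.A_bdd m m (sol.x t₀) (sol.y t₀) t₀).2)
  have hle : t₀ ≤ t₀ + τD := by linarith
  have hz : IntervalIntegrable sol.znorm volume t₀ (t₀ + τD) := sol.z_int _ _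
  have hI : 0 ≤ ∫ s in t₀..(t₀ + τD), sol.znorm s :=
    intervalIntegral.integral_nonneg hle fun s _ => sol.znorm_nonneg s
  have hI' := mul_nonneg (Real.sqrt_nonneg 2) hI
  have hpos : 0 < Real.sqrt 2 + τD := add_pos_of_nonneg_of_pos (Real.sqrt_nonneg 2) hτ
  refine le_of_forall_pos_le_add fun η hη => ?_
  obtain ⟨W, hW, hWa, hW0, hWb, hWz⟩ := exists_continuousOn_forall_eventually_mul_le_sub hle hz
    sol.znorm_nonneg (div_pos hη hpos)
  have h := sol.followerDist_le_of_arc ht₀ hφ0 hφ1 hδφ hφ hW hWa hWz hc₀.le hW0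
    (div_pos hη hpos) harc hi t ht
  have h1 := mul_le_mul_of_nonneg_left (hWb t ht) (Real.sqrt_nonneg 2)
  have h2 : η / (Real.sqrt 2 + τD) * (t - t₀) ≤ η / (Real.sqrt 2 + τD) * τD :=
    mul_le_mul_of_nonneg_left (by linarith [ht.2]) (div_pos hη hpos).le
  have h3 : η / (Real.sqrt 2 + τD) * (Real.sqrt 2 + τD) = η := div_mul_cancel₀ _ hpos.ne'
  change sol.followerDist m t ≤ _
  linarith
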